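/- arXiv:2510.13450 — 7 statements merged into one kernel-verified Lean document; each statement's English description precedes it below -/
import Mathlib

section
/- Let X be a measurable space and D a probability measure on X × ℝ such that the label Y satisfies Y ∈ {0,1} D-almost surely. For every measurable predictor f : X → [0,1], the smooth calibration error and the post-processing gap satisfy smCE(f,D)² ≤ pGap(f,D) ≤ 2·smCE(f,D). -/
open MeasureTheory Set

/-- Smooth calibration error of a predictor `f` w.r.t. a distribution `D` on `X × ℝ`:
the supremum over all 1-Lipschitz `h : [0,1] → [-1,1]` of `E[h(f(X))·(Y − f(X))]`. -/
noncomputable def smCE {X : Type*} [MeasurableSpace X] (D : Measure (X × ℝ)) (f : X → ℝ) : ℝ :=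
  sSup {r : ℝ | ∃ h : ℝ → ℝ, LipschitzOnWith 1 h (Icc 0 1) ∧
    (∀ v ∈ Icc (0:ℝ) 1, h v ∈ Icc (-1:ℝ) 1) ∧
    r = ∫ p, h (f p.1) * (p.2 - f p.1) ∂D}

/-- Post-processing gap of `f` w.r.t. `D`: the squared-loss risk of `f` minus the infimum of
the squared-loss risk of `f + h ∘ f` over 1-Lipschitz `h : [0,1] → [-1,1]`. -/
noncomputable def pGap {X : Type*} [MeasurableSpace X] (D : Measure (X × ℝ)) (f : X → ℝ) : ℝ :=
  (∫ p, (p.2 - f p.1) ^ 2 ∂D) -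
    sInf {r : ℝ | ∃ h : ℝ → ℝ, LipschitzOnWith 1 h (Icc 0 1) ∧
      (∀ v ∈ Icc (0:ℝ) 1, h v ∈ Icc (-1:ℝ) 1) ∧
      r = ∫ p, (p.2 - f p.1 - h (f p.1)) ^ 2 ∂D}

section PostProcessing

variable {X : Type*} [MeasurableSpace X] {D : Measure (X × ℝ)} {f : X → ℝ} {h : ℝ → ℝ}

lemma measurable_lipschitzOn_comp (hf : Measurable f) (hf01 : ∀ x, f x ∈ Icc (0:ℝ) 1)
    (hL : LipschitzOnWith 1 h (Icc 0 1)) : Measurable fun p : X × ℝ => h (f p.1) := by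
  obtain ⟨g, hg, hgh⟩ := hL.extend_real
  have heq : (fun p : X × ℝ => h (f p.1)) = fun p => g (f p.1) :=
    funext fun p => hgh (hf01 p.1)
  rw [heq]
  exact hg.continuous.measurable.comp (hf.comp measurable_fst)

lemma residual_abs_le_one (hY : ∀ᵐ p ∂D, p.2 = 0 ∨ p.2 = 1)
    (hf01 : ∀ x, f x ∈ Icc (0:ℝ) 1) : ∀ᵐ p ∂D, |p.2 - f p.1| ≤ 1 := by
  filter_upwards [hY] with p hp
  have h01 := hf01 p.1
  rw [abs_le]
  rcases hp with hp | hp <;> rw [hp] <;> constructor <;> linarith [h01.1, h01.2]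

variable [IsProbabilityMeasure D]

lemma correlation_abs_le_one (hY : ∀ᵐ p ∂D, p.2 = 0 ∨ p.2 = 1)
    (hf01 : ∀ x, f x ∈ Icc (0:ℝ) 1) (hB : ∀ v ∈ Icc (0:ℝ) 1, h v ∈ Icc (-1:ℝ) 1) :
    |∫ p, h (f p.1) * (p.2 - f p.1) ∂D| ≤ 1 := by
  have hbound : ∀ᵐ p ∂D, ‖h (f p.1) * (p.2 - f p.1)‖ ≤ 1 := by
    filter_upwards [residual_abs_le_one hY hf01] with p hp
    rw [Real.norm_eq_abs, abs_mul]
    exact mul_le_one₀ (abs_le.2 (hB _ (hf01 p.1))) (abs_nonneg _) hp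
  simpa using norm_integral_le_of_norm_le_const hbound

lemma integral_sq_comp_mem_Icc (hf01 : ∀ x, f x ∈ Icc (0:ℝ) 1)
    (hB : ∀ v ∈ Icc (0:ℝ) 1, h v ∈ Icc (-1:ℝ) 1) :
    ∫ p, h (f p.1) ^ 2 ∂D ∈ Icc (0:ℝ) 1 := by
  refine ⟨integral_nonneg fun p => sq_nonneg _, ?_⟩
  have hbound : ∀ᵐ p ∂D, ‖h (f p.1) ^ 2‖ ≤ 1 := .of_forall fun p => by
    rw [Real.norm_eq_abs, abs_pow]
    exact pow_le_one₀ (abs_nonneg _) (abs_le.2 (hB _ (hf01 p.1)))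
  exact (le_abs_self _).trans (by simpa using norm_integral_le_of_norm_le_const hbound)

/-- The squared-loss improvement of `f + h ∘ f` over `f`, expressed through the correlation of
`h ∘ f` with the residual. -/
lemma integral_sq_residual_sub (hY : ∀ᵐ p ∂D, p.2 = 0 ∨ p.2 = 1) (hf : Measurable f)
    (hf01 : ∀ x, f x ∈ Icc (0:ℝ) 1) (hL : LipschitzOnWith 1 h (Icc 0 1))
    (hB : ∀ v ∈ Icc (0:ℝ) 1, h v ∈ Icc (-1:ℝ) 1) :
    ∫ p, (p.2 - f p.1 - h (f p.1)) ^ 2 ∂D = ∫ p, (p.2 - f p.1) ^ 2 ∂D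
      - 2 * ∫ p, h (f p.1) * (p.2 - f p.1) ∂D + ∫ p, h (f p.1) ^ 2 ∂D := by
  have hh : MemLp (fun p : X × ℝ => h (f p.1)) 2 D :=
    .of_bound (measurable_lipschitzOn_comp hf hf01 hL).aestronglyMeasurable 1
      (.of_forall fun p => abs_le.2 (hB _ (hf01 p.1)))
  have hr : MemLp (fun p : X × ℝ => p.2 - f p.1) 2 D :=
    .of_bound (measurable_snd.sub (hf.comp measurable_fst)).aestronglyMeasurable 1
      (residual_abs_le_one hY hf01)
  have hhr : Integrable (fun p : X × ℝ => h (f p.1) * (p.2 - f p.1)) D := hh.integrable_mul hr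
  have hsub : Integrable
      (fun p : X × ℝ => (p.2 - f p.1) ^ 2 - 2 * (h (f p.1) * (p.2 - f p.1))) D :=
    hr.integrable_sq.sub (hhr.const_mul 2)
  rw [← integral_const_mul, ← integral_sub hr.integrable_sq (hhr.const_mul 2),
    ← integral_add hsub hh.integrable_sq]
  congr 1 with p
  ring

lemma correlation_le_smCE (hY : ∀ᵐ p ∂D, p.2 = 0 ∨ p.2 = 1)
    (hf01 : ∀ x, f x ∈ Icc (0:ℝ) 1) (hL : LipschitzOnWith 1 h (Icc 0 1))
    (hB : ∀ v ∈ Icc (0:ℝ) 1, h v ∈ Icc (-1:ℝ) 1) :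
    ∫ p, h (f p.1) * (p.2 - f p.1) ∂D ≤ smCE D f := by
  refine le_csSup ⟨1, ?_⟩ ⟨h, hL, hB, rfl⟩
  rintro _ ⟨g, -, hg, rfl⟩
  exact (le_abs_self _).trans (correlation_abs_le_one hY hf01 hg)

lemma improvement_le_pGap (hY : ∀ᵐ p ∂D, p.2 = 0 ∨ p.2 = 1) (hf : Measurable f)
    (hf01 : ∀ x, f x ∈ Icc (0:ℝ) 1) (hL : LipschitzOnWith 1 h (Icc 0 1))
    (hB : ∀ v ∈ Icc (0:ℝ) 1, h v ∈ Icc (-1:ℝ) 1) :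
    2 * ∫ p, h (f p.1) * (p.2 - f p.1) ∂D - ∫ p, h (f p.1) ^ 2 ∂D ≤ pGap D f := by
  have hinf : sInf {r : ℝ | ∃ h : ℝ → ℝ, LipschitzOnWith 1 h (Icc 0 1) ∧
      (∀ v ∈ Icc (0:ℝ) 1, h v ∈ Icc (-1:ℝ) 1) ∧
      r = ∫ p, (p.2 - f p.1 - h (f p.1)) ^ 2 ∂D} ≤ ∫ p, (p.2 - f p.1 - h (f p.1)) ^ 2 ∂D := by
    refine csInf_le ⟨0, ?_⟩ ⟨h, hL, hB, rfl⟩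
    rintro _ ⟨g, -, -, rfl⟩
    exact integral_nonneg fun p => sq_nonneg _
  rw [integral_sq_residual_sub hY hf hf01 hL hB] at hinf
  unfold pGap
  linarith

/-- Rescaling `h` by its own correlation with the residual achieves an improvement of at least the
square of that correlation. -/
lemma sq_correlation_le_pGap (hY : ∀ᵐ p ∂D, p.2 = 0 ∨ p.2 = 1) (hf : Measurable f)
    (hf01 : ∀ x, f x ∈ Icc (0:ℝ) 1) (hL : LipschitzOnWith 1 h (Icc 0 1))
    (hB : ∀ v ∈ Icc (0:ℝ) 1, h v ∈ Icc (-1:ℝ) 1) :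
    (∫ p, h (f p.1) * (p.2 - f p.1) ∂D) ^ 2 ≤ pGap D f := by
  have ha : |∫ p, h (f p.1) * (p.2 - f p.1) ∂D| ≤ 1 := correlation_abs_le_one hY hf01 hB
  set a := ∫ p, h (f p.1) * (p.2 - f p.1) ∂D with ha_def
  have hL' : LipschitzOnWith 1 (fun v => a * h v) (Icc 0 1) := by
    refine LipschitzOnWith.of_dist_le_mul fun x hx y hy => ?_
    have hxy := hL.dist_le_mul x hx y hy
    rw [Real.dist_eq] at hxy ⊢
    rw [← mul_sub, abs_mul]
    exact (mul_le_of_le_one_left (abs_nonneg _) ha).trans hxy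
  have hB' : ∀ v ∈ Icc (0:ℝ) 1, a * h v ∈ Icc (-1:ℝ) 1 := fun v hv => by
    refine abs_le.1 ?_
    rw [abs_mul]
    exact mul_le_one₀ ha (abs_nonneg _) (abs_le.2 (hB v hv))
  have key := improvement_le_pGap hY hf hf01 hL' hB'
  simp only [mul_assoc, mul_pow, integral_const_mul] at key
  rw [← ha_def] at key
  have hsq := (integral_sq_comp_mem_Icc (D := D) hf01 hB).2
  nlinarith [mul_le_mul_of_nonneg_left hsq (sq_nonneg a)]

end PostProcessing

/-- for a probability measure `D` with labels in `{0,1}` a.s. and a measurable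
predictor `f : X → [0,1]`, we have `smCE(f,D)² ≤ pGap(f,D) ≤ 2·smCE(f,D)`. -/
theorem smCE_sq_le_pGap_and_pGap_le_two_smCE
    {X : Type*} [MeasurableSpace X] (D : Measure (X × ℝ)) [IsProbabilityMeasure D]
    (hY : ∀ᵐ p ∂D, p.2 = 0 ∨ p.2 = 1)
    (f : X → ℝ) (hf : Measurable f) (hf01 : ∀ x, f x ∈ Icc (0:ℝ) 1) :
    smCE D f ^ 2 ≤ pGap D f ∧ pGap D f ≤ 2 * smCE D f := by
  have h0L : LipschitzOnWith 1 (fun _ : ℝ => (0:ℝ)) (Icc 0 1) :=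
    (LipschitzWith.const' 0).lipschitzOnWith
  have h0B : ∀ v ∈ Icc (0:ℝ) 1, (fun _ : ℝ => (0:ℝ)) v ∈ Icc (-1:ℝ) 1 := by simp
  constructor
  · have hs0 : 0 ≤ smCE D f := by simpa using correlation_le_smCE hY hf01 h0L h0B
    have hp0 : 0 ≤ pGap D f := by simpa using sq_correlation_le_pGap hY hf hf01 h0L h0B
    have hle : smCE D f ≤ √(pGap D f) := by
      refine csSup_le ⟨_, _, h0L, h0B, rfl⟩ ?_
      rintro _ ⟨h, hL, hB, rfl⟩
      exact Real.le_sqrt_of_sq_le (sq_correlation_le_pGap hY hf hf01 hL hB)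
    exact (Real.le_sqrt hs0 hp0).1 hle
  · unfold pGap
    rw [sub_le_comm]
    refine le_csInf ⟨_, _, h0L, h0B, rfl⟩ ?_
    rintro _ ⟨h, hL, hB, rfl⟩
    rw [integral_sq_residual_sub hY hf hf01 hL hB]
    linarith [correlation_le_smCE hY hf01 hL hB,
      (integral_sq_comp_mem_Icc (D := D) hf01 hB).1]
end

section
/- Let X be a set and S = ((x₁,y₁),…,(xₙ,yₙ)) a sample with xᵢ ∈ X and yᵢ ∈ {0,1}. For every f : X → [0,1], the empirical smooth calibration error and the empirical post-processing gap satisfy smCE(f,S)² ≤ pGap(f,S) ≤ 2·smCE(f,S). -/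
open MeasureTheory Set

/-- Empirical smooth calibration error of `f` on a sample `S = ((x₁,y₁),…,(xₙ,yₙ))`:
the supremum over 1-Lipschitz `h : [0,1] → [-1,1]` of `(1/n)Σᵢ h(f(xᵢ))·(yᵢ − f(xᵢ))`. -/
noncomputable def smCEemp {X : Type*} (n : ℕ) (S : Fin n → X × ℝ) (f : X → ℝ) : ℝ :=
  sSup {r : ℝ | ∃ h : ℝ → ℝ, LipschitzOnWith 1 h (Icc 0 1) ∧
    (∀ v ∈ Icc (0:ℝ) 1, h v ∈ Icc (-1:ℝ) 1) ∧
    r = (1 / n : ℝ) * ∑ i, h (f (S i).1) * ((S i).2 - f (S i).1)}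

/-- Empirical post-processing gap of `f` on a sample `S`. -/
noncomputable def pGapemp {X : Type*} (n : ℕ) (S : Fin n → X × ℝ) (f : X → ℝ) : ℝ :=
  (1 / n : ℝ) * ∑ i, ((S i).2 - f (S i).1) ^ 2 -
    sInf {r : ℝ | ∃ h : ℝ → ℝ, LipschitzOnWith 1 h (Icc 0 1) ∧
      (∀ v ∈ Icc (0:ℝ) 1, h v ∈ Icc (-1:ℝ) 1) ∧
      r = (1 / n : ℝ) * ∑ i, ((S i).2 - f (S i).1 - h (f (S i).1)) ^ 2}

/-- The mean square of `a - b` expanded around the mean square of `a`. -/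
lemma mean_sub_sq {n : ℕ} (a b : Fin n → ℝ) :
    (1 / n : ℝ) * ∑ i, (a i - b i) ^ 2 =
      (1 / n : ℝ) * ∑ i, a i ^ 2 - 2 * ((1 / n : ℝ) * ∑ i, b i * a i) +
        (1 / n : ℝ) * ∑ i, b i ^ 2 := by
  have h : ∑ i, (a i - b i) ^ 2 = ∑ i, a i ^ 2 - 2 * ∑ i, b i * a i + ∑ i, b i ^ 2 := by
    rw [Finset.mul_sum, ← Finset.sum_sub_distrib, ← Finset.sum_add_distrib]
    exact Finset.sum_congr rfl fun i _ => by ring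
  rw [h]
  ring

/-- A mean of numbers of absolute value at most one has absolute value at most one. -/
lemma abs_mean_le_one {n : ℕ} {b : Fin n → ℝ} (hb : ∀ i, |b i| ≤ 1) :
    |(1 / n : ℝ) * ∑ i, b i| ≤ 1 := by
  have hsum : |∑ i, b i| ≤ n :=
    (Finset.abs_sum_le_sum_abs _ _).trans
      ((Finset.sum_le_sum fun i _ => hb i).trans (by simp))
  rw [abs_mul, abs_of_nonneg (by positivity : (0 : ℝ) ≤ 1 / n), one_div, inv_mul_eq_div]
  exact div_le_one_of_le₀ hsum n.cast_nonneg

/-- Scaling a `1`-Lipschitz function by a factor in `[-1, 1]` keeps it `1`-Lipschitz. -/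
lemma LipschitzOnWith.const_mul_of_abs_le_one {h : ℝ → ℝ} {s : Set ℝ}
    (hh : LipschitzOnWith 1 h s) {r : ℝ} (hr : |r| ≤ 1) :
    LipschitzOnWith 1 (fun v => r * h v) s := by
  refine LipschitzOnWith.of_dist_le_mul fun x hx y hy => ?_
  have hxy := hh.dist_le_mul x hx y hy
  rw [Real.dist_eq] at hxy ⊢
  rw [← mul_sub, abs_mul]
  exact (mul_le_of_le_one_left (abs_nonneg _) hr).trans hxy

/-- for a sample with binary labels and `f : X → [0,1]`,
`smCE(f,S)² ≤ pGap(f,S) ≤ 2·smCE(f,S)`. -/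
theorem smCEemp_sq_le_pGapemp_and_pGapemp_le_two_smCEemp
    {X : Type*} (n : ℕ) (hn : 0 < n) (S : Fin n → X × ℝ)
    (hy : ∀ i, (S i).2 = 0 ∨ (S i).2 = 1)
    (f : X → ℝ) (hf01 : ∀ x, f x ∈ Icc (0:ℝ) 1) :
    smCEemp n S f ^ 2 ≤ pGapemp n S f ∧ pGapemp n S f ≤ 2 * smCEemp n S f := by
  have hres : ∀ i, |(S i).2 - f (S i).1| ≤ 1 := fun i => by
    obtain ⟨h0, h1⟩ := hf01 (S i).1
    rw [abs_le]
    rcases hy i with h | h <;> rw [h] <;> constructor <;> linarith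
  have hcorr : ∀ h : ℝ → ℝ, (∀ v ∈ Icc (0:ℝ) 1, h v ∈ Icc (-1:ℝ) 1) →
      |(1 / n : ℝ) * ∑ i, h (f (S i).1) * ((S i).2 - f (S i).1)| ≤ 1 := fun h hb =>
    abs_mean_le_one fun i => by
      rw [abs_mul]
      exact mul_le_one₀ (abs_le.2 (hb _ (hf01 _))) (abs_nonneg _) (hres i)
  have hzero : LipschitzOnWith 1 (fun _ : ℝ => (0 : ℝ)) (Icc 0 1) ∧
      ∀ v ∈ Icc (0:ℝ) 1, (fun _ : ℝ => (0 : ℝ)) v ∈ Icc (-1:ℝ) 1 :=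
    ⟨(LipschitzWith.const' 0).lipschitzOnWith, fun v _ => by norm_num⟩
  have hle_smCE : ∀ h : ℝ → ℝ, LipschitzOnWith 1 h (Icc 0 1) →
      (∀ v ∈ Icc (0:ℝ) 1, h v ∈ Icc (-1:ℝ) 1) →
      (1 / n : ℝ) * ∑ i, h (f (S i).1) * ((S i).2 - f (S i).1) ≤ smCEemp n S f := by
    intro h hl hb
    refine le_csSup ⟨1, ?_⟩ ⟨h, hl, hb, rfl⟩
    rintro _ ⟨g, -, hg, rfl⟩
    exact (abs_le.1 (hcorr g hg)).2
  have hsmCE_nonneg : 0 ≤ smCEemp n S f := by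
    simpa using hle_smCE _ hzero.1 hzero.2
  have hle_pGap : ∀ h : ℝ → ℝ, LipschitzOnWith 1 h (Icc 0 1) →
      (∀ v ∈ Icc (0:ℝ) 1, h v ∈ Icc (-1:ℝ) 1) →
      2 * ((1 / n : ℝ) * ∑ i, h (f (S i).1) * ((S i).2 - f (S i).1)) -
        (1 / n : ℝ) * ∑ i, h (f (S i).1) ^ 2 ≤ pGapemp n S f := by
    intro h hl hb
    have hinf : (1 / n : ℝ) * ∑ i, ((S i).2 - f (S i).1) ^ 2 -
        (1 / n : ℝ) * ∑ i, ((S i).2 - f (S i).1 - h (f (S i).1)) ^ 2 ≤ pGapemp n S f := by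
      rw [pGapemp]
      refine sub_le_sub_left ?_ _
      refine csInf_le ⟨0, ?_⟩ ⟨h, hl, hb, rfl⟩
      rintro _ ⟨g, -, -, rfl⟩
      positivity
    rw [mean_sub_sq (fun i => (S i).2 - f (S i).1) (fun i => h (f (S i).1))] at hinf
    linarith
  constructor
  · have hpGap_nonneg : 0 ≤ pGapemp n S f := by
      simpa using hle_pGap _ hzero.1 hzero.2
    refine (Real.le_sqrt hsmCE_nonneg hpGap_nonneg).1 ?_
    refine csSup_le ⟨_, _, hzero.1, hzero.2, rfl⟩ ?_
    rintro _ ⟨h, hl, hb, rfl⟩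
    refine Real.le_sqrt_of_sq_le ?_
    have hr := hcorr h hb
    set r := (1 / n : ℝ) * ∑ i, h (f (S i).1) * ((S i).2 - f (S i).1) with hr_def
    have hscaled := hle_pGap (fun v => r * h v) (hl.const_mul_of_abs_le_one hr) fun v hv =>
      abs_le.1 <| by
        rw [abs_mul]
        exact mul_le_one₀ hr (abs_nonneg _) (abs_le.2 (hb v hv))
    have hlin : (1 / n : ℝ) * ∑ i, r * h (f (S i).1) * ((S i).2 - f (S i).1) = r * r := by
      simp_rw [mul_assoc r]
      rw [← Finset.mul_sum, mul_left_comm, ← hr_def]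
    have hquad : (1 / n : ℝ) * ∑ i, (r * h (f (S i).1)) ^ 2 =
        r ^ 2 * ((1 / n : ℝ) * ∑ i, h (f (S i).1) ^ 2) := by
      simp_rw [mul_pow]
      rw [← Finset.mul_sum, mul_left_comm]
    have hsq : (1 / n : ℝ) * ∑ i, h (f (S i).1) ^ 2 ≤ 1 :=
      (abs_le.1 (abs_mean_le_one fun i => by
        rw [abs_pow]
        exact pow_le_one₀ (abs_nonneg _) (abs_le.2 (hb _ (hf01 _))))).2
    rw [hlin, hquad] at hscaled
    linarith [mul_le_of_le_one_right (sq_nonneg r) hsq]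
  · have hinf : (1 / n : ℝ) * ∑ i, ((S i).2 - f (S i).1) ^ 2 - 2 * smCEemp n S f ≤
        sInf {r : ℝ | ∃ h : ℝ → ℝ, LipschitzOnWith 1 h (Icc 0 1) ∧
          (∀ v ∈ Icc (0:ℝ) 1, h v ∈ Icc (-1:ℝ) 1) ∧
          r = (1 / n : ℝ) * ∑ i, ((S i).2 - f (S i).1 - h (f (S i).1)) ^ 2} := by
      refine le_csInf ⟨_, _, hzero.1, hzero.2, rfl⟩ ?_
      rintro _ ⟨h, hl, hb, rfl⟩
      rw [mean_sub_sq (fun i => (S i).2 - f (S i).1) (fun i => h (f (S i).1))]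
      have hsq : 0 ≤ (1 / n : ℝ) * ∑ i, h (f (S i).1) ^ 2 := by positivity
      linarith [hle_smCE h hl hb]
    rw [pGapemp]
    linarith
end

section
/- Let F be a set of real-valued functions on X, ν : F → ℝ with 0 ≤ ν(f) ≤ 1 for every f ∈ F, λ ≥ 0, S = ((x₁,y₁),…,(xₙ,yₙ)) a sample with labels yᵢ ∈ {0,1}, L_n(f) := (1/n)Σᵢ(yᵢ − f(xᵢ))² + λ·ν(f)², and let f*_n ∈ F be a minimizer of L_n over F; set err_n(f) := L_n(f) − L_n(f*_n). If f ∈ F takes values in [0,1] and for every 1-Lipschitz h : [0,1] → [−1,1] the function x ↦ f(x) + h(f(x)) belongs to F, then the empirical post-processing gap satisfies pGap(f,S) ≤ λ + err_n(f). -/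
open MeasureTheory Set

/-- under L₂-regularized ERM with regularizer `λ·ν(f)²` and a hypothesis class
closed under Lipschitz post-processing of `f`, the empirical post-processing gap of `f`
is at most `λ + err_n(f)`. -/
theorem pGapemp_le_lambda_add_err
    {X : Type*} (F : Set (X → ℝ)) (ν : (X → ℝ) → ℝ)
    (hν : ∀ f ∈ F, ν f ∈ Icc (0:ℝ) 1)
    (lam : ℝ) (hlam : 0 ≤ lam)
    (n : ℕ) (hn : 0 < n) (S : Fin n → X × ℝ)
    (hy : ∀ i, (S i).2 = 0 ∨ (S i).2 = 1)
    (Ln : (X → ℝ) → ℝ)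
    (hLn : ∀ f, Ln f = (1 / n : ℝ) * ∑ i, ((S i).2 - f (S i).1) ^ 2 + lam * ν f ^ 2)
    (fstar : X → ℝ) (hfstarF : fstar ∈ F) (hmin : ∀ f ∈ F, Ln fstar ≤ Ln f)
    (f : X → ℝ) (hfF : f ∈ F) (hf01 : ∀ x, f x ∈ Icc (0:ℝ) 1)
    (hclosed : ∀ h : ℝ → ℝ, LipschitzOnWith 1 h (Icc 0 1) →
      (∀ v ∈ Icc (0:ℝ) 1, h v ∈ Icc (-1:ℝ) 1) → (fun x => f x + h (f x)) ∈ F) :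
    pGapemp n S f ≤ lam + (Ln f - Ln fstar) := by
  have hbound : (1 / n : ℝ) * ∑ i, ((S i).2 - f (S i).1) ^ 2 - (lam + (Ln f - Ln fstar)) ≤
      sInf {r : ℝ | ∃ h : ℝ → ℝ, LipschitzOnWith 1 h (Icc 0 1) ∧
        (∀ v ∈ Icc (0:ℝ) 1, h v ∈ Icc (-1:ℝ) 1) ∧
        r = (1 / n : ℝ) * ∑ i, ((S i).2 - f (S i).1 - h (f (S i).1)) ^ 2} := by
    refine le_csInf ⟨_, fun _ => 0, LipschitzWith.const' 0 |>.lipschitzOnWith, ?_, rfl⟩ ?_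
    · intro v _
      norm_num
    · rintro r ⟨h, hLip, hrange, rfl⟩
      have hmem := hclosed h hLip hrange
      have hle := hmin _ hmem
      obtain ⟨hν0, hν1⟩ := hν _ hmem
      have hreg := mul_le_mul_of_nonneg_left (pow_le_one₀ (n := 2) hν0 hν1) hlam
      have hreg_f := mul_nonneg hlam (sq_nonneg (ν f))
      have hf := hLn f
      rw [hLn (fun x => f x + h (f x))] at hle
      simp only [← sub_sub] at hle
      linarith
  unfold pGapemp
  linarith
end

section
/- Let F be a set of real-valued functions on X, ν : F → ℝ with 0 ≤ ν(f) ≤ 1 for every f ∈ F, λ ≥ 0, S = ((x₁,y₁),…,(xₙ,yₙ)) a sample with labels yᵢ ∈ {0,1}, L_n(f) := (1/n)Σᵢ(yᵢ − f(xᵢ))² + λ·ν(f)², and let f*_n ∈ F be a minimizer of L_n over F; set err_n(f) := L_n(f) − L_n(f*_n). If f ∈ F takes values in [0,1] and for every 1-Lipschitz h : [0,1] → [−1,1] the function x ↦ f(x) + h(f(x)) belongs to F, then the empirical smooth calibration error satisfies smCE(f,S) ≤ √(λ + err_n(f)). -/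
open MeasureTheory Set

/-- Expansion of the empirical squared loss along a perturbation `c • g` with `|g| ≤ 1`, where `c`
is the empirical correlation of `g` with the residual `d`: the loss drops by at least `c ^ 2`. -/
theorem mean_sq_sub_corr_mul_le {n : ℕ} (hn : 0 < n) (d g : Fin n → ℝ) (c : ℝ)
    (hc : c = (1 / n : ℝ) * ∑ i, g i * d i) (hg : ∀ i, g i ^ 2 ≤ 1) :
    (1 / n : ℝ) * ∑ i, (d i - c * g i) ^ 2 ≤ (1 / n : ℝ) * ∑ i, d i ^ 2 - c ^ 2 := by
  have hn' : (0 : ℝ) < n := by exact_mod_cast hn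
  have hsum : ∑ i, g i * d i = n * c := by
    rw [hc]; field_simp
  have hterm : ∀ i, (d i - c * g i) ^ 2 ≤ d i ^ 2 - 2 * c * (g i * d i) + c ^ 2 := fun i => by
    nlinarith [mul_le_mul_of_nonneg_left (hg i) (sq_nonneg c)]
  have hle : ∑ i, (d i - c * g i) ^ 2 ≤ ∑ i, d i ^ 2 - n * c ^ 2 := by
    refine (Finset.sum_le_sum fun i _ => hterm i).trans_eq ?_
    rw [Finset.sum_add_distrib, Finset.sum_sub_distrib, ← Finset.mul_sum, hsum]
    simp only [Finset.sum_const, Finset.card_univ, Fintype.card_fin, nsmul_eq_mul]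
    ring
  calc (1 / n : ℝ) * ∑ i, (d i - c * g i) ^ 2
      ≤ (1 / n : ℝ) * (∑ i, d i ^ 2 - n * c ^ 2) := by gcongr
    _ = (1 / n : ℝ) * ∑ i, d i ^ 2 - c ^ 2 := by field_simp

/-- under L₂-regularized ERM with regularizer `λ·ν(f)²` and a hypothesis class
closed under Lipschitz post-processing of `f`, the empirical smooth calibration error of `f`
is at most `√(λ + err_n(f))`. -/
theorem smCEemp_le_sqrt_lambda_add_err
    {X : Type*} (F : Set (X → ℝ)) (ν : (X → ℝ) → ℝ)
    (hν : ∀ f ∈ F, ν f ∈ Icc (0:ℝ) 1)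
    (lam : ℝ) (hlam : 0 ≤ lam)
    (n : ℕ) (hn : 0 < n) (S : Fin n → X × ℝ)
    (hy : ∀ i, (S i).2 = 0 ∨ (S i).2 = 1)
    (Ln : (X → ℝ) → ℝ)
    (hLn : ∀ f, Ln f = (1 / n : ℝ) * ∑ i, ((S i).2 - f (S i).1) ^ 2 + lam * ν f ^ 2)
    (fstar : X → ℝ) (hfstarF : fstar ∈ F) (hmin : ∀ f ∈ F, Ln fstar ≤ Ln f)
    (f : X → ℝ) (hfF : f ∈ F) (hf01 : ∀ x, f x ∈ Icc (0:ℝ) 1)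
    (hclosed : ∀ h : ℝ → ℝ, LipschitzOnWith 1 h (Icc 0 1) →
      (∀ v ∈ Icc (0:ℝ) 1, h v ∈ Icc (-1:ℝ) 1) → (fun x => f x + h (f x)) ∈ F) :
    smCEemp n S f ≤ Real.sqrt (lam + (Ln f - Ln fstar)) := by
  refine Real.sSup_le ?_ (Real.sqrt_nonneg _)
  rintro r ⟨h, hlip, hbd, hr⟩
  rcases le_or_gt r 0 with hr0 | hr0
  · exact hr0.trans (Real.sqrt_nonneg _)
  have hn' : (0 : ℝ) < n := by exact_mod_cast hn
  have habs : ∀ v ∈ Icc (0 : ℝ) 1, |h v| ≤ 1 := fun v hv => abs_le.2 (hbd v hv)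
  have hr1 : r ≤ 1 := by
    have hterm : ∀ i, h (f (S i).1) * ((S i).2 - f (S i).1) ≤ 1 := fun i => by
      have hres : |(S i).2 - f (S i).1| ≤ 1 := by
        have := hf01 (S i).1
        rw [abs_le]
        rcases hy i with h0 | h0 <;> rw [h0] <;> constructor <;> linarith [this.1, this.2]
      refine (le_abs_self _).trans ?_
      rw [abs_mul]
      exact mul_le_one₀ (habs _ (hf01 _)) (abs_nonneg _) hres
    have hsum := Finset.sum_le_sum fun i (_ : i ∈ Finset.univ) => hterm i
    simp only [Finset.sum_const, Finset.card_univ, Fintype.card_fin, nsmul_eq_mul,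
      mul_one] at hsum
    rw [hr, one_div, inv_mul_le_iff₀ hn', mul_one]
    exact hsum
  have hmem : (fun x => f x + r * h (f x)) ∈ F := by
    refine hclosed (fun v => r * h v) ?_ fun v hv => ?_
    · refine LipschitzOnWith.of_dist_le_mul fun u hu v hv => ?_
      have hd := hlip.dist_le_mul u hu v hv
      rw [Real.dist_eq] at hd ⊢
      rw [← mul_sub, abs_mul, abs_of_pos hr0]
      exact (mul_le_of_le_one_left (abs_nonneg _) hr1).trans hd
    · rw [mem_Icc, ← abs_le, abs_mul, abs_of_pos hr0]
      exact mul_le_one₀ hr1 (abs_nonneg _) (habs v hv)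
  have hdrop := mean_sq_sub_corr_mul_le hn (fun i => (S i).2 - f (S i).1)
    (fun i => h (f (S i).1)) r hr fun i => (sq_le_one_iff_abs_le_one _).2 (habs _ (hf01 _))
  have hopt := hmin _ hmem
  rw [hLn fun x => f x + r * h (f x)] at hopt
  simp only [← sub_sub] at hopt
  have hνg : lam * ν (fun x => f x + r * h (f x)) ^ 2 ≤ lam :=
    mul_le_of_le_one_right hlam (pow_le_one₀ (hν _ hmem).1 (hν _ hmem).2)
  have hνf : 0 ≤ lam * ν f ^ 2 := mul_nonneg hlam (sq_nonneg _)
  refine Real.le_sqrt_of_sq_le ?_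
  linarith [hLn f]
end

section
/- Let X be a measurable space, D a probability measure on X × ℝ with Y ∈ {0,1} D-almost surely, F a set of measurable functions X → ℝ, μ : F → ℝ a complexity measure, and λ > 0. Suppose f* ∈ F takes values in [0,1] and minimizes f ↦ E_{(X,Y)∼D}[(Y − f(X))²] + λ·μ(f) over F, and suppose that for every 1-Lipschitz h : [0,1] → [−1,1] the function x ↦ f*(x) + h(f*(x)) belongs to F and satisfies μ(f* + h∘f*) ≤ μ(f*) + 1. Then pGap(f*,D) ≤ λ, and therefore smCE(f*,D) ≤ √λ. -/
open MeasureTheory Set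

/-- Post-processing a `[0,1]`-valued measurable function by a function that is Lipschitz on `[0,1]`
gives a measurable function. -/
theorem LipschitzOnWith.measurable_comp_Icc {X : Type*} [MeasurableSpace X] {f : X → ℝ}
    {h : ℝ → ℝ} {K : NNReal} (hh : LipschitzOnWith K h (Icc 0 1)) (hf : Measurable f)
    (hf01 : ∀ x, f x ∈ Icc (0:ℝ) 1) : Measurable fun x => h (f x) := by
  obtain ⟨g, hg, hgh⟩ := hh.extend_real
  have heq : (fun x => h (f x)) = g ∘ f := funext fun x => hgh (hf01 x)
  exact heq ▸ hg.continuous.measurable.comp hf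

/-- The squared-loss improvement of any admissible post-processing is at most `pGap`. -/
theorem sub_integral_le_pGap {X : Type*} [MeasurableSpace X] (D : Measure (X × ℝ)) (f : X → ℝ)
    {h : ℝ → ℝ} (hLip : LipschitzOnWith 1 h (Icc 0 1))
    (hb : ∀ v ∈ Icc (0:ℝ) 1, h v ∈ Icc (-1:ℝ) 1) :
    (∫ p, (p.2 - f p.1) ^ 2 ∂D) - ∫ p, (p.2 - f p.1 - h (f p.1)) ^ 2 ∂D ≤ pGap D f := by
  refine sub_le_sub_left ?_ _
  refine csInf_le ⟨0, ?_⟩ ⟨h, hLip, hb, rfl⟩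
  rintro _ ⟨g, -, -, rfl⟩
  exact integral_nonneg fun p => sq_nonneg _

/-- If `u` is bounded by `1` in absolute value, shifting `r` by `t * u` decreases the expected
square by at least `2 * t * E[u * r] - t ^ 2`. -/
theorem two_mul_integral_mul_sub_sq_le {Ω : Type*} [MeasurableSpace Ω] (P : Measure Ω)
    [IsProbabilityMeasure P] {r u : Ω → ℝ} (hr : MemLp r 2 P) (hu : MemLp u 2 P)
    (hu1 : ∀ᵐ ω ∂P, |u ω| ≤ 1) (t : ℝ) :
    2 * t * (∫ ω, u ω * r ω ∂P) - t ^ 2 ≤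
      (∫ ω, r ω ^ 2 ∂P) - ∫ ω, (r ω - t * u ω) ^ 2 ∂P := by
  have hshift : MemLp (fun ω => r ω - t * u ω) 2 P := hr.sub (hu.const_mul t)
  have hur : Integrable (fun ω => u ω * r ω) P := hu.integrable_mul hr
  rw [← integral_sub hr.integrable_sq hshift.integrable_sq, ← integral_const_mul]
  have hconst : ∫ _ω : Ω, t ^ 2 ∂P = t ^ 2 := by simp
  rw [← hconst, ← integral_sub (hur.const_mul _) (integrable_const _)]
  refine integral_mono_ae ((hur.const_mul _).sub (integrable_const _))
    (hr.integrable_sq.sub hshift.integrable_sq) ?_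
  filter_upwards [hu1] with ω hω
  have hsq : u ω ^ 2 ≤ 1 := (sq_le_one_iff_abs_le_one _).2 hω
  nlinarith [mul_le_mul_of_nonneg_left hsq (sq_nonneg t)]

/-- The smooth calibration error is at most the square root of the post-processing gap. -/
theorem smCE_le_sqrt_pGap {X : Type*} [MeasurableSpace X] (D : Measure (X × ℝ))
    [IsProbabilityMeasure D] (hY : ∀ᵐ p ∂D, p.2 = 0 ∨ p.2 = 1) {f : X → ℝ} (hf : Measurable f)
    (hf01 : ∀ x, f x ∈ Icc (0:ℝ) 1) : smCE D f ≤ √(pGap D f) := by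
  refine Real.sSup_le ?_ (Real.sqrt_nonneg _)
  rintro _ ⟨h, hLip, hb, rfl⟩
  have hres_bound : ∀ᵐ p ∂D, |p.2 - f p.1| ≤ 1 := by
    filter_upwards [hY] with p hp
    have := hf01 p.1
    rw [abs_le]
    rcases hp with hp | hp <;> rw [hp] <;> constructor <;> linarith [this.1, this.2]
  have hpost_bound : ∀ p : X × ℝ, |h (f p.1)| ≤ 1 := fun p => abs_le.2 (hb _ (hf01 p.1))
  have hres : MemLp (fun p : X × ℝ => p.2 - f p.1) 2 D :=
    MemLp.of_bound (measurable_snd.sub (hf.comp measurable_fst)).aestronglyMeasurable 1 hres_bound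
  have hpost : MemLp (fun p : X × ℝ => h (f p.1)) 2 D :=
    MemLp.of_bound
      ((hLip.measurable_comp_Icc hf hf01).comp measurable_fst).aestronglyMeasurable 1
      (.of_forall hpost_bound)
  set s := ∫ p, h (f p.1) * (p.2 - f p.1) ∂D with hs
  have hs_abs : |s| ≤ 1 := by
    have := norm_integral_le_of_norm_le_const (μ := D) (C := 1)
      (f := fun p : X × ℝ => h (f p.1) * (p.2 - f p.1)) (by
        filter_upwards [hres_bound] with p hp
        rw [Real.norm_eq_abs, abs_mul]
        exact mul_le_one₀ (hpost_bound p) (abs_nonneg _) hp)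
    simpa using this
  refine Real.le_sqrt_of_sq_le ?_
  have hscaled := sub_integral_le_pGap D f (h := fun v => s * h v)
    (LipschitzOnWith.of_dist_le_mul fun x hx y hy => by
      rw [Real.dist_eq, ← mul_sub, abs_mul, ← Real.dist_eq]
      calc |s| * dist (h x) (h y) ≤ 1 * dist (h x) (h y) := by gcongr
        _ = dist (h x) (h y) := one_mul _
        _ ≤ _ := hLip.dist_le_mul x hx y hy)
    (fun v hv => abs_le.1 <| by
      rw [abs_mul]
      exact mul_le_one₀ hs_abs (abs_nonneg _) (abs_le.2 (hb v hv)))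
  have hgain := two_mul_integral_mul_sub_sq_le D hres hpost (.of_forall hpost_bound) s
  rw [← hs] at hgain
  linarith

/-- Claim 5.1 of Błasiok et al.: if `f*` minimizes the regularized population
squared-loss risk `E[(Y − f(X))²] + λ·μ(f)` over `F`, and `F` together with `μ` is suitably
closed under Lipschitz post-processing of `f*`, then `pGap(f*,D) ≤ λ` and
`smCE(f*,D) ≤ √λ`. -/
theorem pGap_le_lambda_of_population_min
    {X : Type*} [MeasurableSpace X] (D : Measure (X × ℝ)) [IsProbabilityMeasure D]
    (hY : ∀ᵐ p ∂D, p.2 = 0 ∨ p.2 = 1)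
    (F : Set (X → ℝ)) (μc : (X → ℝ) → ℝ) (lam : ℝ) (hlam : 0 < lam)
    (fstar : X → ℝ) (hmeas : Measurable fstar) (hfF : fstar ∈ F)
    (hf01 : ∀ x, fstar x ∈ Icc (0:ℝ) 1)
    (hmin : ∀ f ∈ F, (∫ p, (p.2 - fstar p.1) ^ 2 ∂D) + lam * μc fstar ≤
      (∫ p, (p.2 - f p.1) ^ 2 ∂D) + lam * μc f)
    (hclosed : ∀ h : ℝ → ℝ, LipschitzOnWith 1 h (Icc 0 1) →
      (∀ v ∈ Icc (0:ℝ) 1, h v ∈ Icc (-1:ℝ) 1) →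
      (fun x => fstar x + h (fstar x)) ∈ F ∧
        μc (fun x => fstar x + h (fstar x)) ≤ μc fstar + 1) :
    pGap D fstar ≤ lam ∧ smCE D fstar ≤ Real.sqrt lam := by
  have hgap : pGap D fstar ≤ lam := by
    refine sub_le_comm.1 (le_csInf ⟨_, fun _ => 0, LipschitzOnWith.of_dist_le_mul (by simp),
      by simp, rfl⟩ ?_)
    rintro _ ⟨h, hLip, hb, rfl⟩
    obtain ⟨hmem, hcost⟩ := hclosed h hLip hb
    have hle := hmin _ hmem
    simp only [← sub_sub] at hle
    linarith [mul_le_mul_of_nonneg_left hcost hlam.le]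
  exact ⟨hgap, (smCE_le_sqrt_pGap D hY hmeas hf01).trans (Real.sqrt_le_sqrt hgap)⟩
end

section
/- Let X be a set and S = ((x₁,y₁),…,(xₙ,yₙ)) a sample with xᵢ ∈ X and yᵢ ∈ {0,1}. For every g : X → ℝ, the empirical dual smooth calibration error and the empirical dual post-processing gap satisfy 2·smCE^{ψ,1/4}(g,S)² ≤ pGap^{ψ,1/4}(g,S) ≤ 4·smCE^{ψ,1/4}(g,S). -/
open Set
open scoped NNReal

/-- The sigmoid function `σ(s) = 1/(1+e^{−s})`. -/
noncomputable def sigm (s : ℝ) : ℝ := 1 / (1 + Real.exp (-s))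

/-- The logistic (dual) loss `ℓ^ψ(s,y) = log(1+eˢ) − s·y`. -/
noncomputable def logisticLoss (s y : ℝ) : ℝ := Real.log (1 + Real.exp s) - s * y

/-- Empirical dual smooth calibration error of a logit function `g` on a sample `S`. -/
noncomputable def smCEdualEmp {X : Type*} (n : ℕ) (S : Fin n → X × ℝ) (g : X → ℝ) : ℝ :=
  sSup {r : ℝ | ∃ h : ℝ → ℝ, LipschitzWith (1/4 : ℝ≥0) h ∧ (∀ v : ℝ, h v ∈ Icc (-1:ℝ) 1) ∧
    r = (1 / n : ℝ) * ∑ i, h (g (S i).1) * ((S i).2 - sigm (g (S i).1))}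

/-- Empirical dual post-processing gap of a logit function `g` on a sample `S`. -/
noncomputable def pGapdualEmp {X : Type*} (n : ℕ) (S : Fin n → X × ℝ) (g : X → ℝ) : ℝ :=
  (1 / n : ℝ) * ∑ i, logisticLoss (g (S i).1) (S i).2 -
    sInf {r : ℝ | ∃ h : ℝ → ℝ, LipschitzWith 1 h ∧ (∀ v : ℝ, h v ∈ Icc (-4:ℝ) 4) ∧
      r = (1 / n : ℝ) * ∑ i, logisticLoss (g (S i).1 + h (g (S i).1)) (S i).2}

/-- A differentiable function with monotone derivative lies above its tangent lines. -/
lemma add_deriv_mul_le_of_monotone {F f : ℝ → ℝ} (hF : ∀ u, HasDerivAt F (f u) u)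
    (hf : Monotone f) (s t : ℝ) : F s + f s * t ≤ F (s + t) := by
  have hc : Continuous F := continuous_iff_continuousAt.2 fun u => (hF u).continuousAt
  rcases lt_trichotomy t 0 with ht | rfl | ht
  · obtain ⟨c, hcm, hce⟩ := exists_hasDerivAt_eq_slope F f (show s + t < s by linarith)
      hc.continuousOn fun u _ => hF u
    have h := hf hcm.2.le
    rw [hce, div_le_iff₀ (by linarith)] at h
    linarith
  · simp
  · obtain ⟨c, hcm, hce⟩ := exists_hasDerivAt_eq_slope F f (show s < s + t by linarith)
      hc.continuousOn fun u _ => hF u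
    have h := hf hcm.1.le
    rw [hce, le_div_iff₀ (by linarith)] at h
    linarith

lemma sigm_eq_sigmoid : sigm = Real.sigmoid := by
  ext s
  simp [sigm, Real.sigmoid_def]

lemma sigm_mem_Icc (s : ℝ) : sigm s ∈ Icc (0 : ℝ) 1 := by
  rw [sigm_eq_sigmoid]
  exact ⟨Real.sigmoid_nonneg s, Real.sigmoid_le_one s⟩

lemma hasDerivAt_log_one_add_exp (s : ℝ) :
    HasDerivAt (fun u => Real.log (1 + Real.exp u)) (sigm s) s := by
  have h := ((Real.hasDerivAt_exp s).const_add 1).log (by positivity)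
  convert h using 1
  rw [sigm, Real.exp_neg]
  field_simp
  ring

lemma monotone_sigm : Monotone sigm := sigm_eq_sigmoid ▸ Real.sigmoid_monotone

lemma monotone_div_four_sub_sigm : Monotone fun s => s / 4 - sigm s := by
  rw [sigm_eq_sigmoid]
  have h (s : ℝ) : HasDerivAt (fun s => s / 4 - Real.sigmoid s)
      (1 / 4 - Real.sigmoid s * (1 - Real.sigmoid s)) s :=
    ((hasDerivAt_id s).div_const 4).sub (Real.hasDerivAt_sigmoid s)
  refine monotone_of_deriv_nonneg (fun s => (h s).differentiableAt) fun s => ?_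
  rw [(h s).deriv]
  nlinarith [sq_nonneg (Real.sigmoid s - 1 / 2)]

/-- First-order convexity lower bound for the logistic loss. -/
lemma logisticLoss_sub_le (s t y : ℝ) :
    logisticLoss s y - t * (y - sigm s) ≤ logisticLoss (s + t) y := by
  have h := add_deriv_mul_le_of_monotone hasDerivAt_log_one_add_exp monotone_sigm s t
  simp only [logisticLoss]
  linarith

/-- Smoothness upper bound for the logistic loss. -/
lemma logisticLoss_add_le (s t y : ℝ) :
    logisticLoss (s + t) y ≤ logisticLoss s y - t * (y - sigm s) + t ^ 2 / 8 := by
  have hd (u : ℝ) : HasDerivAt (fun u => u ^ 2 / 8 - Real.log (1 + Real.exp u))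
      (u / 4 - sigm u) u := by
    refine (((hasDerivAt_pow 2 u).div_const 8).sub (hasDerivAt_log_one_add_exp u)).congr_deriv ?_
    push_cast
    ring
  have h := add_deriv_mul_le_of_monotone hd monotone_div_four_sub_sigm s t
  simp only [logisticLoss]
  linarith

section Empirical

variable {X : Type*} {n : ℕ} {S : Fin n → X × ℝ} {g : X → ℝ}

/-- The average of terms bounded by `1` is at most `1`. -/
lemma mean_le_one {a : Fin n → ℝ} (ha : ∀ i, a i ≤ 1) : (1 / n : ℝ) * ∑ i, a i ≤ 1 := by
  have h : ∑ i, a i ≤ n := by simpa using Finset.sum_le_sum fun i (_ : i ∈ Finset.univ) => ha i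
  rw [one_div_mul_eq_div]
  exact div_le_one_of_le₀ h (Nat.cast_nonneg n)

lemma mean_mul_residual_le_one (hy : ∀ i, (S i).2 = 0 ∨ (S i).2 = 1) {h : ℝ → ℝ}
    (hb : ∀ v, h v ∈ Icc (-1 : ℝ) 1) :
    (1 / n : ℝ) * ∑ i, h (g (S i).1) * ((S i).2 - sigm (g (S i).1)) ≤ 1 := by
  refine mean_le_one fun i => ?_
  obtain ⟨h₁, h₂⟩ := hb (g (S i).1)
  obtain ⟨h₃, h₄⟩ := sigm_mem_Icc (g (S i).1)
  rcases hy i with e | e <;> rw [e] <;> nlinarith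

/-- Every admissible test function bounds the smooth calibration error from below. -/
lemma le_smCEdualEmp (hy : ∀ i, (S i).2 = 0 ∨ (S i).2 = 1) {h : ℝ → ℝ}
    (hl : LipschitzWith (1 / 4 : ℝ≥0) h) (hb : ∀ v, h v ∈ Icc (-1 : ℝ) 1) :
    (1 / n : ℝ) * ∑ i, h (g (S i).1) * ((S i).2 - sigm (g (S i).1)) ≤ smCEdualEmp n S g := by
  refine le_csSup ⟨1, ?_⟩ ⟨h, hl, hb, rfl⟩
  rintro r ⟨k, -, hk, rfl⟩
  exact mean_mul_residual_le_one hy hk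

lemma smCEdualEmp_nonneg (hy : ∀ i, (S i).2 = 0 ∨ (S i).2 = 1) : 0 ≤ smCEdualEmp n S g := by
  simpa using le_smCEdualEmp (n := n) (S := S) (g := g) hy (h := fun _ => 0)
    (LipschitzWith.const' 0) (by simp)

/-- First-order lower bound for the mean loss after post-processing. -/
lemma mean_logisticLoss_sub_le (h : ℝ → ℝ) :
    (1 / n : ℝ) * ∑ i, logisticLoss (g (S i).1) (S i).2 -
        (1 / n : ℝ) * ∑ i, h (g (S i).1) * ((S i).2 - sigm (g (S i).1)) ≤
      (1 / n : ℝ) * ∑ i, logisticLoss (g (S i).1 + h (g (S i).1)) (S i).2 := by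
  rw [← mul_sub, ← Finset.sum_sub_distrib]
  gcongr
  exact logisticLoss_sub_le _ _ _

lemma mean_logisticLoss_sub_four_smCEdualEmp_le (hy : ∀ i, (S i).2 = 0 ∨ (S i).2 = 1)
    {h : ℝ → ℝ} (hl : LipschitzWith 1 h) (hb : ∀ v, h v ∈ Icc (-4 : ℝ) 4) :
    (1 / n : ℝ) * ∑ i, logisticLoss (g (S i).1) (S i).2 - 4 * smCEdualEmp n S g ≤
      (1 / n : ℝ) * ∑ i, logisticLoss (g (S i).1 + h (g (S i).1)) (S i).2 := by
  have hk := le_smCEdualEmp (n := n) (S := S) (g := g) hy (h := fun v => 1 / 4 * h v)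
    (LipschitzWith.of_dist_le_mul fun u v => by
      have := hl.dist_le_mul u v
      simp only [Real.dist_eq, ← mul_sub, abs_mul] at *
      norm_num at *
      linarith)
    (fun v => ⟨by linarith [(hb v).1], by linarith [(hb v).2]⟩)
  simp only [mul_assoc, ← Finset.mul_sum] at hk
  linarith [mean_logisticLoss_sub_le (S := S) (g := g) h]

/-- Every admissible post-processing bounds the gap from below. -/
lemma sub_le_pGapdualEmp (hy : ∀ i, (S i).2 = 0 ∨ (S i).2 = 1) {h : ℝ → ℝ}
    (hl : LipschitzWith 1 h) (hb : ∀ v, h v ∈ Icc (-4 : ℝ) 4) :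
    (1 / n : ℝ) * ∑ i, logisticLoss (g (S i).1) (S i).2 -
      (1 / n : ℝ) * ∑ i, logisticLoss (g (S i).1 + h (g (S i).1)) (S i).2 ≤
        pGapdualEmp n S g := by
  refine sub_le_sub_left ?_ _
  refine csInf_le
    ⟨(1 / n : ℝ) * ∑ i, logisticLoss (g (S i).1) (S i).2 - 4 * smCEdualEmp n S g, ?_⟩
    ⟨h, hl, hb, rfl⟩
  rintro r ⟨k, hkl, hkb, rfl⟩
  exact mean_logisticLoss_sub_four_smCEdualEmp_le hy hkl hkb

lemma pGapdualEmp_le_four_smCEdualEmp (hy : ∀ i, (S i).2 = 0 ∨ (S i).2 = 1) :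
    pGapdualEmp n S g ≤ 4 * smCEdualEmp n S g := by
  refine sub_le_comm.1 (le_csInf ⟨_, fun _ => 0, LipschitzWith.const' 0, by simp, rfl⟩ ?_)
  rintro r ⟨k, hkl, hkb, rfl⟩
  exact mean_logisticLoss_sub_four_smCEdualEmp_le hy hkl hkb

/-- Rescaling a test function of nonnegative correlation `r` by `4 * r` gains at least `2 * r ^ 2`
in mean loss. -/
lemma two_mul_sq_le_pGapdualEmp (hy : ∀ i, (S i).2 = 0 ∨ (S i).2 = 1) {h : ℝ → ℝ}
    (hl : LipschitzWith (1 / 4 : ℝ≥0) h) (hb : ∀ v, h v ∈ Icc (-1 : ℝ) 1) {r : ℝ}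
    (hr : r = (1 / n : ℝ) * ∑ i, h (g (S i).1) * ((S i).2 - sigm (g (S i).1))) (hr0 : 0 ≤ r) :
    2 * r ^ 2 ≤ pGapdualEmp n S g := by
  have hr1 : r ≤ 1 := hr ▸ mean_mul_residual_le_one hy hb
  have hgap := sub_le_pGapdualEmp (n := n) (S := S) (g := g) hy (h := fun v => 4 * r * h v)
    (LipschitzWith.of_dist_le_mul fun u v => by
      have h₁ := hl.dist_le_mul u v
      simp only [Real.dist_eq, ← mul_sub, abs_mul, abs_of_nonneg hr0] at *
      norm_num at *
      nlinarith [abs_nonneg (u - v), abs_nonneg (h u - h v)])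
    (fun v => by
      obtain ⟨h₁, h₂⟩ := hb v
      constructor <;> nlinarith)
  have hsmooth : (1 / n : ℝ) * ∑ i, logisticLoss (g (S i).1 + 4 * r * h (g (S i).1)) (S i).2 ≤
      (1 / n : ℝ) * ∑ i, (logisticLoss (g (S i).1) (S i).2 -
        4 * r * (h (g (S i).1) * ((S i).2 - sigm (g (S i).1))) +
          2 * r ^ 2 * h (g (S i).1) ^ 2) := by
    gcongr with i
    refine (logisticLoss_add_le _ _ _).trans_eq ?_
    ring
  have hsq : (1 / n : ℝ) * ∑ i, h (g (S i).1) ^ 2 ≤ 1 := mean_le_one fun i =>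
    (sq_le_one_iff_abs_le_one _).2 (abs_le.2 (hb _))
  rw [Finset.sum_add_distrib, Finset.sum_sub_distrib, ← Finset.mul_sum, ← Finset.mul_sum,
    mul_add, mul_sub, mul_left_comm _ (4 * r), mul_left_comm _ (2 * r ^ 2), ← hr] at hsmooth
  nlinarith [mul_le_mul_of_nonneg_left hsq (sq_nonneg r)]

lemma two_mul_smCEdualEmp_sq_le_pGapdualEmp (hy : ∀ i, (S i).2 = 0 ∨ (S i).2 = 1) :
    2 * smCEdualEmp n S g ^ 2 ≤ pGapdualEmp n S g := by
  have hgap : 0 ≤ pGapdualEmp n S g := by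
    simpa using sub_le_pGapdualEmp (n := n) (S := S) (g := g) hy (h := fun _ => 0)
      (LipschitzWith.const' 0) (by simp)
  have hle : smCEdualEmp n S g ≤ √(pGapdualEmp n S g / 2) := by
    refine csSup_le ⟨_, fun _ => 0, LipschitzWith.const' 0, by simp, rfl⟩ ?_
    rintro r ⟨h, hl, hb, hr⟩
    rcases le_total r 0 with hr0 | hr0
    · exact hr0.trans (Real.sqrt_nonneg _)
    · refine Real.le_sqrt_of_sq_le ?_
      linarith [two_mul_sq_le_pGapdualEmp hy hl hb hr hr0]
  have hsq := (Real.le_sqrt (smCEdualEmp_nonneg hy) (by linarith)).1 hle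
  linarith

end Empirical

/-- for a sample with binary labels and any `g : X → ℝ`,
`2·smCE^{ψ,1/4}(g,S)² ≤ pGap^{ψ,1/4}(g,S) ≤ 4·smCE^{ψ,1/4}(g,S)`. -/
theorem smCEdualEmp_sq_le_pGapdualEmp_and_pGapdualEmp_le_four_smCEdualEmp
    {X : Type*} (n : ℕ) (hn : 0 < n) (S : Fin n → X × ℝ)
    (hy : ∀ i, (S i).2 = 0 ∨ (S i).2 = 1) (g : X → ℝ) :
    2 * smCEdualEmp n S g ^ 2 ≤ pGapdualEmp n S g ∧
      pGapdualEmp n S g ≤ 4 * smCEdualEmp n S g := by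
  exact ⟨two_mul_smCEdualEmp_sq_le_pGapdualEmp hy, pGapdualEmp_le_four_smCEdualEmp hy⟩
end

section
/- Let H be a real inner product space, X a set, φ : X → H a feature map with ‖φ(x)‖² ≤ Λ for all x ∈ X, where Λ ≥ 1, and let α ≥ 0. Fix sample points x₁,…,xₙ ∈ X and let F := { x ↦ ⟨w, φ(x)⟩ + b : w ∈ H with ‖w‖ ≤ α, b ∈ ℝ with |b| ≤ αΛ + 1 }. Then the empirical Rademacher complexity of F satisfies R̂(F) ≤ (3αΛ + 2)/√n. -/
open Set
open scoped RealInnerProductSpace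

/-- Empirical Rademacher complexity of a class `F` at sample points `x₁,…,xₙ`:
`E_σ[sup_{f∈F}(1/n)Σᵢ σᵢ f(xᵢ)]`, the expectation over uniform signs realized as an average
over `ε : Fin n → Bool` with `σᵢ = ±1`. -/
noncomputable def radEmp {X : Type*} (n : ℕ) (F : Set (X → ℝ)) (x : Fin n → X) : ℝ :=
  (1 / 2 ^ n : ℝ) * ∑ ε : Fin n → Bool,
    sSup {r : ℝ | ∃ f ∈ F, r = (1 / n : ℝ) * ∑ i, (if ε i then (1:ℝ) else -1) * f (x i)}

/-- Second moment of a Rademacher sum: the cross terms cancel. -/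
theorem sum_norm_sq_rademacher {E : Type*} [NormedAddCommGroup E] [InnerProductSpace ℝ E]
    {n : ℕ} (v : Fin n → E) :
    ∑ ε : Fin n → Bool, ‖∑ i, (if ε i then (1 : ℝ) else -1) • v i‖ ^ 2
      = 2 ^ n * ∑ i, ‖v i‖ ^ 2 := by
  induction n with
  | zero => simp
  | succ n ih =>
    rw [← (Fin.consEquiv fun _ : Fin (n + 1) => Bool).sum_comp, Fintype.sum_prod_type,
      Fintype.sum_bool, ← Finset.sum_add_distrib]
    have key (ε : Fin n → Bool) :
        ‖v 0 + ∑ i, (if ε i then (1 : ℝ) else -1) • v i.succ‖ ^ 2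
          + ‖-v 0 + ∑ i, (if ε i then (1 : ℝ) else -1) • v i.succ‖ ^ 2
          = 2 * ‖v 0‖ ^ 2
            + 2 * ‖∑ i, (if ε i then (1 : ℝ) else -1) • v i.succ‖ ^ 2 := by
      rw [norm_add_sq_real, norm_add_sq_real, inner_neg_left, norm_neg]
      ring
    simp only [Fin.consEquiv, Equiv.coe_fn_mk, Fin.sum_univ_succ, Fin.cons_zero, Fin.cons_succ,
      if_true, Bool.false_eq_true, if_false, one_smul, neg_one_smul, key,
      Finset.sum_add_distrib, ← Finset.mul_sum, ih fun i => v i.succ]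
    simp
    ring

/-- First moment bound for a Rademacher sum of vectors of squared norm at most `C`. -/
theorem sum_norm_rademacher_le {E : Type*} [NormedAddCommGroup E] [InnerProductSpace ℝ E]
    {n : ℕ} (v : Fin n → E) {C : ℝ} (hv : ∀ i, ‖v i‖ ^ 2 ≤ C) :
    ∑ ε : Fin n → Bool, ‖∑ i, (if ε i then (1 : ℝ) else -1) • v i‖
      ≤ 2 ^ n * (√n * √C) := by
  have hcs := sq_sum_le_card_mul_sum_sq (s := (Finset.univ : Finset (Fin n → Bool)))
    (f := fun ε => ‖∑ i, (if ε i then (1 : ℝ) else -1) • v i‖)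
  have hsum : ∑ i, ‖v i‖ ^ 2 ≤ n * C := by
    simpa using Finset.sum_le_sum fun i (_ : i ∈ Finset.univ) => hv i
  rw [sum_norm_sq_rademacher, Finset.card_univ, Fintype.card_fun, Fintype.card_bool,
    Fintype.card_fin] at hcs
  push_cast at hcs
  rw [← Real.sqrt_mul n.cast_nonneg, ← Real.sqrt_sq (by positivity : (0 : ℝ) ≤ 2 ^ n),
    ← Real.sqrt_mul (by positivity)]
  refine Real.le_sqrt_of_sq_le (hcs.trans ?_)
  rw [← mul_assoc, ← sq]
  gcongr

/-- the empirical Rademacher complexity of the class of kernel predictors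
`x ↦ ⟨w, φ(x)⟩ + b` with `‖w‖ ≤ α` and `|b| ≤ αΛ + 1`, where `‖φ(x)‖² ≤ Λ` and `Λ ≥ 1`,
is at most `(3αΛ + 2)/√n`. -/
theorem radEmp_kernel_class_le
    {H : Type*} [NormedAddCommGroup H] [InnerProductSpace ℝ H]
    {X : Type*} (φ : X → H) (Λ : ℝ) (hΛ : 1 ≤ Λ) (hφ : ∀ x, ‖φ x‖ ^ 2 ≤ Λ)
    (α : ℝ) (hα : 0 ≤ α) (n : ℕ) (hn : 0 < n) (x : Fin n → X)
    (F : Set (X → ℝ))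
    (hF : F = {f | ∃ (w : H) (b : ℝ), ‖w‖ ≤ α ∧ |b| ≤ α * Λ + 1 ∧
      f = fun x' => ⟪w, φ x'⟫ + b}) :
    radEmp n F x ≤ (3 * α * Λ + 2) / Real.sqrt n := by
  have hn' : (0 : ℝ) < n := by exact_mod_cast hn
  have hB : 0 ≤ α * Λ + 1 := by positivity
  have hsup (ε : Fin n → Bool) :
      sSup {r : ℝ | ∃ f ∈ F, r = (1 / n : ℝ) * ∑ i, (if ε i then (1 : ℝ) else -1) * f (x i)}
        ≤ (1 / n : ℝ) * (α * ‖∑ i, (if ε i then (1 : ℝ) else -1) • φ (x i)‖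
          + (α * Λ + 1) * ‖∑ i, (if ε i then (1 : ℝ) else -1) • (1 : ℝ)‖) := by
    refine Real.sSup_le ?_ (by positivity)
    rintro r ⟨f, hf, rfl⟩
    rw [hF] at hf
    obtain ⟨w, b, hw, hb, rfl⟩ := hf
    have hsplit : ∑ i, (if ε i then (1 : ℝ) else -1) * (⟪w, φ (x i)⟫ + b)
        = ⟪w, ∑ i, (if ε i then (1 : ℝ) else -1) • φ (x i)⟫
          + b * ∑ i, (if ε i then (1 : ℝ) else -1) • (1 : ℝ) := by
      simp only [inner_sum, real_inner_smul_right, Finset.mul_sum, ← Finset.sum_add_distrib,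
        smul_eq_mul]
      exact Finset.sum_congr rfl fun i _ => by ring
    rw [hsplit]
    refine mul_le_mul_of_nonneg_left (add_le_add ?_ ?_) (by positivity)
    · exact (real_inner_le_norm _ _).trans (by gcongr)
    · refine (le_abs_self _).trans ?_
      rw [abs_mul, Real.norm_eq_abs]
      gcongr
  have hsqrt : √Λ ≤ Λ := Real.sqrt_le_self_iff.2 (Or.inr hΛ)
  have hw := sum_norm_rademacher_le (fun i => φ (x i)) fun i => hφ (x i)
  have hb := sum_norm_rademacher_le (fun _ : Fin n => (1 : ℝ)) (C := 1) (by simp)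
  have hαΛ : α * √Λ ≤ α * Λ := by gcongr
  calc radEmp n F x
      ≤ (1 / 2 ^ n : ℝ) * ∑ ε : Fin n → Bool,
          (1 / n : ℝ) * (α * ‖∑ i, (if ε i then (1 : ℝ) else -1) • φ (x i)‖
            + (α * Λ + 1) * ‖∑ i, (if ε i then (1 : ℝ) else -1) • (1 : ℝ)‖) := by
        unfold radEmp
        gcongr with ε
        exact hsup ε
    _ ≤ (1 / 2 ^ n : ℝ) * ((1 / n : ℝ) * (α * (2 ^ n * (√n * √Λ))
          + (α * Λ + 1) * (2 ^ n * (√n * √1)))) := by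
        rw [← Finset.mul_sum, Finset.sum_add_distrib, ← Finset.mul_sum, ← Finset.mul_sum]
        gcongr
    _ = (α * √Λ + (α * Λ + 1)) / √n := by
        have hs : 0 < √(n : ℝ) := Real.sqrt_pos.2 hn'
        rw [Real.sqrt_one, div_eq_mul_inv _ (√(n : ℝ)), ← Real.sqrt_div_self]
        field_simp
    _ ≤ (3 * α * Λ + 2) / √n := by
        have : 0 ≤ α * Λ := by positivity
        exact div_le_div_of_nonneg_right (by linarith) (Real.sqrt_nonneg _)
end
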